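/- arXiv:2001.04703 — 2 statements merged into one kernel-verified Lean document; each statement's English description precedes it below -/
import Mathlib

section
/- The sum over k ≥ 1 of [-1/2 - 2k² log(1 - 1/(4k²))] converges and equals 7ζ(3)/(4π²) + 1/4 - (1/2) log 2. -/
open Real

namespace SumLog

open Filter Topology MeasureTheory

noncomputable def g (x : ℝ) : ℝ := x / (π * sinc (π * x))

lemma sinc_pos {x : ℝ} (hx : x ∈ Set.Icc (0:ℝ) (1/2)) : 0 < sinc (π * x) := by
  rcases eq_or_lt_of_le hx.1 with h | h
  · simp [← h]
  · have h1 : 0 < π * x := by positivity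
    rw [sinc_of_ne_zero h1.ne']
    refine div_pos (sin_pos_of_pos_of_lt_pi h1 ?_) h1
    nlinarith [pi_pos, hx.2]

lemma g_cont : ContinuousOn g (Set.Icc (0:ℝ) (1/2)) := by
  unfold g
  refine ContinuousOn.div continuousOn_id ?_ ?_
  · exact (continuous_const.mul (continuous_sinc.comp (by fun_prop))).continuousOn
  · intro x hx
    have := sinc_pos hx
    positivity

lemma g_sin {x : ℝ} (hx : x ∈ Set.Icc (0:ℝ) (1/2)) : g x * sin (π * x) = x ^ 2 := by
  rcases eq_or_lt_of_le hx.1 with h | h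
  · simp [← h]
  · have h1 : 0 < π * x := by positivity
    have h2 := sinc_pos hx
    unfold g
    rw [sinc_of_ne_zero h1.ne'] at *
    have h3 : sin (π * x) ≠ 0 := by
      intro h; simp [h] at h2
    generalize sin (π * x) = s at *
    field_simp

lemma RL : Tendsto (fun N : ℕ => ∫ x in (0:ℝ)..(1/2), g x * cos ((2 * N + 1) * (π * x)))
    atTop (𝓝 0) := by
  have hint : IntervalIntegrable g volume 0 (1/2) := by
    apply ContinuousOn.intervalIntegrable
    rw [Set.uIcc_of_le (by norm_num)]
    exact g_cont
  have hint' : IntegrableOn g (Set.Ioc 0 (1/2)) := by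
    rwa [intervalIntegrable_iff_integrableOn_Ioc_of_le (by norm_num)] at hint
  have h := Real.tendsto_integral_exp_smul_cocompact
    ((Set.Ioc (0:ℝ) (1/2)).indicator (fun x => (g x : ℂ)))
  have h2 : Tendsto (fun N : ℕ => (N : ℝ) + 1/2) atTop (cocompact ℝ) := by
    refine Tendsto.mono_right ?_ atTop_le_cocompact
    exact tendsto_atTop_add_const_right _ _ tendsto_natCast_atTop_atTop
  have h3 := (Complex.continuous_re.tendsto _).comp (h.comp h2)
  simp only [Complex.zero_re] at h3
  refine h3.congr fun N => ?_
  simp only [Function.comp]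
  have key : ∀ v : ℝ, (Real.fourierChar (-(v * ((N:ℝ) + 1/2))) •
      (Set.Ioc (0:ℝ) (1/2)).indicator (fun x => (g x : ℂ)) v : ℂ) =
      (Set.Ioc (0:ℝ) (1/2)).indicator
        (fun v => Complex.exp (((-(2 * N + 1) * (π * v) : ℝ) : ℂ) * Complex.I) * (g v : ℂ)) v := by
    intro v
    by_cases hv : v ∈ Set.Ioc (0:ℝ) (1/2)
    · simp only [Set.indicator_of_mem hv, Circle.smul_def, Real.fourierChar_apply, smul_eq_mul]
      congr 3
      push_cast
      ring
    · simp only [Set.indicator_of_notMem hv, smul_zero]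
  simp_rw [key]
  rw [integral_indicator measurableSet_Ioc, intervalIntegral.integral_of_le (by norm_num)]
  have hI : Integrable (fun v : ℝ => Complex.exp (((-(2 * N + 1) * (π * v) : ℝ) : ℂ) * Complex.I)
      * (g v : ℂ)) (volume.restrict (Set.Ioc 0 (1/2))) := by
    refine Integrable.bdd_mul (c := 1) (Integrable.ofReal hint') ?_ ?_
    · exact Continuous.aestronglyMeasurable (by fun_prop)
    · refine Eventually.of_forall fun v => ?_
      rw [Complex.norm_exp_ofReal_mul_I]
  have := integral_re hI
  simp only [RCLike.re_eq_complex_re] at this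
  rw [← this]
  congr 1
  ext v
  rw [Complex.re_mul_ofReal, Complex.exp_ofReal_mul_I_re, mul_comm, neg_mul, Real.cos_neg]

lemma dirichlet (N : ℕ) (t : ℝ) :
    cos t = (∑ n ∈ Finset.range N, 2 * sin (2 * (n + 1) * t)) * sin t + cos ((2 * N + 1) * t) := by
  induction N with
  | zero => simp
  | succ N ih =>
    rw [Finset.sum_range_succ, add_mul]
    have e1 : cos ((2 * N + 1) * t) = cos (2 * (N + 1) * t - t) := by congr 1; ring
    have e2 : cos ((2 * (N + 1 : ℕ) + 1) * t) = cos (2 * (N + 1) * t + t) := by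
      congr 1; push_cast; ring
    rw [e2, cos_add]
    rw [e1, cos_sub] at ih
    linarith

lemma int_sin (n : ℕ) : ∫ x in (0:ℝ)..(1/2), x ^ 2 * (2 * sin (2 * (n + 1) * (π * x))) =
    (-1) ^ n / (n + 1) / (4 * π) - (1 + (-1) ^ n) / (n + 1) ^ 3 / (2 * π ^ 3) := by
  set a : ℝ := 2 * (n + 1) * π with ha
  have ha0 : a ≠ 0 := by positivity
  have hd : ∀ x ∈ Set.uIcc (0:ℝ) (1/2), HasDerivAt
      (fun x => 2 * (-x ^ 2 * cos (a * x) / a + 2 * x * sin (a * x) / a ^ 2 + 2 * cos (a * x) / a ^ 3))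
      (x ^ 2 * (2 * sin (2 * (n + 1) * (π * x)))) x := by
    intro x _
    have hax : HasDerivAt (fun x => a * x) a x := by simpa using (hasDerivAt_id x).const_mul a
    have hc := hax.cos
    have hs := hax.sin
    have h1 := ((((hasDerivAt_pow 2 x).neg).mul hc).div_const a)
    have h2 := ((((hasDerivAt_id x).const_mul 2).mul hs).div_const (a ^ 2))
    have h3 := (hc.const_mul 2).div_const (a ^ 3)
    refine (((h1.add h2).add h3).const_mul 2).congr_deriv ?_
    rw [show 2 * ((n:ℝ) + 1) * (π * x) = a * x by rw [ha]; ring]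
    simp
    field_simp
    ring
  rw [intervalIntegral.integral_eq_sub_of_hasDerivAt hd]
  · have hc : cos (a * (1/2)) = -(-1) ^ n := by
      rw [show a * (1/2) = ((n + 1 : ℕ) : ℝ) * π by rw [ha]; push_cast; ring, cos_nat_mul_pi]
      ring
    have hs : sin (a * (1/2)) = 0 := by
      rw [show a * (1/2) = ((n + 1 : ℕ) : ℝ) * π by rw [ha]; push_cast; ring, sin_nat_mul_pi]
    rw [hc, hs]
    simp only [mul_zero, cos_zero, sin_zero]
    rw [ha]
    field_simp
    ring
  · exact Continuous.intervalIntegrable (by fun_prop) _ _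

lemma alt_harm (N : ℕ) : ∑ n ∈ Finset.range (2 * N), (-1 : ℝ) ^ n / (n + 1) =
    (harmonic (2 * N) : ℝ) - harmonic N := by
  induction N with
  | zero => simp
  | succ N ih =>
    rw [show 2 * (N + 1) = 2 * N + 1 + 1 by ring, Finset.sum_range_succ, Finset.sum_range_succ, ih,
      harmonic_succ, harmonic_succ, harmonic_succ]
    push_cast
    rw [pow_succ, pow_mul]
    simp
    field_simp
    ring

lemma alt_tendsto : Tendsto (fun N : ℕ => ∑ n ∈ Finset.range (2 * N), (-1 : ℝ) ^ n / (n + 1))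
    atTop (𝓝 (log 2)) := by
  have h1 := Real.tendsto_harmonic_sub_log
  have h2 : Tendsto (fun N : ℕ => 2 * N) atTop atTop :=
    tendsto_id.const_mul_atTop' (by norm_num)
  have h3 := ((h1.comp h2).sub h1).add_const (log 2)
  simp only [sub_self, zero_add] at h3
  refine h3.congr' ?_
  filter_upwards [eventually_gt_atTop 0] with N hN
  rw [alt_harm]
  have : (N : ℝ) ≠ 0 := by positivity
  simp only [Function.comp]
  push_cast
  rw [log_mul (by norm_num) this]
  ring

lemma cube_sum (N : ℕ) : ∑ n ∈ Finset.range (2 * N), (1 + (-1 : ℝ) ^ n) / (n + 1) ^ 3 =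
    2 * ∑ n ∈ Finset.range (2 * N), 1 / ((n : ℝ) + 1) ^ 3
      - (1 / 4) * ∑ n ∈ Finset.range N, 1 / ((n : ℝ) + 1) ^ 3 := by
  induction N with
  | zero => simp
  | succ N ih =>
    rw [show 2 * (N + 1) = 2 * N + 1 + 1 by ring, Finset.sum_range_succ, Finset.sum_range_succ, ih,
      Finset.sum_range_succ _ (2 * N + 1), Finset.sum_range_succ _ (2 * N),
      Finset.sum_range_succ _ N]
    push_cast
    have e2 : (-1 : ℝ) ^ (2 * N) = 1 := by rw [pow_mul]; norm_num
    rw [pow_succ (-1 : ℝ) (2 * N), e2]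
    have e1 : (1 : ℝ) / (2 * N + 1 + 1) ^ 3 = 1 / 8 * (1 / (N + 1) ^ 3) := by
      field_simp
      ring
    rw [e1]
    ring

lemma cube_tendsto : Tendsto (fun N : ℕ => ∑ n ∈ Finset.range (2 * N),
    (1 + (-1 : ℝ) ^ n) / (n + 1) ^ 3) atTop
    (𝓝 (7 / 4 * ∑' m : ℕ, 1 / ((m : ℝ) + 1) ^ 3)) := by
  have hs : Summable (fun m : ℕ => 1 / ((m : ℝ) + 1) ^ 3) := by
    have := (summable_nat_add_iff 1).2 (Real.summable_one_div_nat_pow (p := 3) |>.2 (by norm_num))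
    simpa using this
  have h1 := hs.hasSum.tendsto_sum_nat
  have h2 : Tendsto (fun N : ℕ => 2 * N) atTop atTop :=
    tendsto_id.const_mul_atTop' (by norm_num)
  have h3 := ((h1.comp h2).const_mul 2).sub (h1.const_mul (1/4))
  simp_rw [cube_sum]
  have e : 7 / 4 * ∑' m : ℕ, 1 / ((m : ℝ) + 1) ^ 3 =
      2 * ∑' m : ℕ, 1 / ((m : ℝ) + 1) ^ 3 - 1 / 4 * ∑' m : ℕ, 1 / ((m : ℝ) + 1) ^ 3 := by ring
  rw [e]
  exact h3

lemma int_cot : ∫ x in (0:ℝ)..(1/2), g x * cos (π * x) =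
    log 2 / (4 * π) - 7 / 4 * (∑' m : ℕ, 1 / ((m : ℝ) + 1) ^ 3) / (2 * π ^ 3) := by
  have hgc : ∀ f : ℝ → ℝ, Continuous f →
      IntervalIntegrable (fun x => g x * f x) volume 0 (1/2) := by
    intro f hf
    apply ContinuousOn.intervalIntegrable
    rw [Set.uIcc_of_le (by norm_num)]
    exact g_cont.mul hf.continuousOn
  have key : ∀ N : ℕ, ∫ x in (0:ℝ)..(1/2), g x * cos (π * x) =
      ∑ n ∈ Finset.range N, ((-1 : ℝ) ^ n / (n + 1) / (4 * π)
        - (1 + (-1) ^ n) / (n + 1) ^ 3 / (2 * π ^ 3))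
      + ∫ x in (0:ℝ)..(1/2), g x * cos ((2 * N + 1) * (π * x)) := by
    intro N
    simp_rw [← int_sin]
    rw [← intervalIntegral.integral_finsetSum, ← intervalIntegral.integral_add]
    · apply intervalIntegral.integral_congr
      intro x hx
      rw [Set.uIcc_of_le (by norm_num)] at hx
      simp only
      rw [← Finset.mul_sum, ← g_sin hx, dirichlet N (π * x)]
      ring
    · exact Continuous.intervalIntegrable (by fun_prop) _ _
    · exact hgc _ (by fun_prop)
    · intro i _
      exact Continuous.intervalIntegrable (by fun_prop) _ _
  have h2 : Tendsto (fun N : ℕ => 2 * N) atTop atTop :=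
    tendsto_id.const_mul_atTop' (by norm_num)
  have h := ((alt_tendsto.div_const (4 * π)).sub (cube_tendsto.div_const (2 * π ^ 3))).add
    (RL.comp h2)
  rw [add_zero] at h
  refine tendsto_nhds_unique (tendsto_const_nhds.congr fun N => ?_) h
  rw [key (2 * N), Finset.sum_sub_distrib, Finset.sum_div, Finset.sum_div]
  rfl

lemma cot_sum {x : ℝ} (hx : x ∈ Set.Icc (0:ℝ) (1/2)) :
    HasSum (fun k : ℕ => 4 * x ^ 3 / (((k : ℝ) + 1) ^ 2 - x ^ 2))
      (2 * x - 2 * π * (g x * cos (π * x))) := by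
  rcases eq_or_lt_of_le hx.1 with h | h
  · simp [← h, g, hasSum_zero]
  have hz : (x : ℂ) ∈ Complex.integerComplement := by
    rintro ⟨n, hn⟩
    have hn' : (n : ℝ) = x := by exact_mod_cast hn
    have h1 : (0 : ℝ) < n := by rw [hn']; exact h
    have h2 : (n : ℝ) < 1 := by rw [hn']; linarith [hx.2]
    have h1' : 0 < n := by exact_mod_cast h1
    have h2' : n < 1 := by exact_mod_cast h2
    omega
  have hs := (summable_cotTerm hz).hasSum
  have e : ∑' n, cotTerm (x : ℂ) n = ((π * (cos (π * x) / sin (π * x)) - 1 / x : ℝ) : ℂ) := by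
    have := cot_series_rep' hz
    unfold cotTerm
    rw [← this, Complex.cot_eq_cos_div_sin]
    push_cast
    rfl
  rw [e] at hs
  have hs' : HasSum (fun k : ℕ => 1 / (x - (k + 1)) + 1 / (x + (k + 1)))
      (π * (cos (π * x) / sin (π * x)) - 1 / x) := by
    rw [← Complex.hasSum_ofReal]
    convert hs using 2 with k
    simp [cotTerm]
  have h3 := hs'.mul_left (-2 * x ^ 2)
  have hsin : sin (π * x) ≠ 0 := by
    refine (sin_pos_of_pos_of_lt_pi (by positivity) ?_).ne'
    nlinarith [pi_pos, hx.2]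
  have hg : g x = x ^ 2 / sin (π * x) := by
    rw [eq_div_iff hsin, g_sin hx]
  have e2 : -2 * x ^ 2 * (π * (cos (π * x) / sin (π * x)) - 1 / x) =
      2 * x - 2 * π * (g x * cos (π * x)) := by
    rw [hg]
    generalize sin (π * x) = s at *
    field_simp
    ring
  rw [e2] at h3
  have e3 : (fun k : ℕ => 4 * x ^ 3 / (((k : ℝ) + 1) ^ 2 - x ^ 2)) =
      fun k : ℕ => -2 * x ^ 2 * (1 / (x - (k + 1)) + 1 / (x + (k + 1))) := by
    funext k
    have hk : (0 : ℝ) ≤ k := Nat.cast_nonneg k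
    have a1 : x - (k + 1) ≠ 0 := by linarith [hx.2]
    have a2 : x + (k + 1) ≠ 0 := by linarith
    have a3 : ((k : ℝ) + 1) ^ 2 - x ^ 2 ≠ 0 := by
      have : ((k : ℝ) + 1) ^ 2 - x ^ 2 = -((x - (k + 1)) * (x + (k + 1))) := by ring
      rw [this]; exact neg_ne_zero.2 (mul_ne_zero a1 a2)
    field_simp
    ring
  rw [e3]
  exact h3

lemma den_pos (k : ℕ) {x : ℝ} (hx : x ∈ Set.Icc (0:ℝ) (1/2)) :
    ((k : ℝ) + 1) ^ 2 / 2 ≤ ((k : ℝ) + 1) ^ 2 - x ^ 2 := by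
  have hk : (0 : ℝ) ≤ k := Nat.cast_nonneg k
  nlinarith [hx.1, hx.2]

lemma int_term (k : ℕ) : ∫ x in (0:ℝ)..(1/2), 4 * x ^ 3 / (((k : ℝ) + 1) ^ 2 - x ^ 2) =
    -(1 / 2 : ℝ) - 2 * ((k : ℝ) + 1) ^ 2 * Real.log (1 - 1 / (4 * ((k : ℝ) + 1) ^ 2)) := by
  set c : ℝ := (k : ℝ) + 1 with hc
  have hc0 : 0 < c := by positivity
  have hpos : ∀ x ∈ Set.Icc (0:ℝ) (1/2), 0 < c ^ 2 - x ^ 2 := fun x hx =>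
    lt_of_lt_of_le (by positivity) (den_pos k hx)
  have hd : ∀ x ∈ Set.uIcc (0:ℝ) (1/2), HasDerivAt
      (fun x => -2 * x ^ 2 - 2 * c ^ 2 * log (1 - x ^ 2 / c ^ 2))
      (4 * x ^ 3 / (c ^ 2 - x ^ 2)) x := by
    intro x hx
    rw [Set.uIcc_of_le (by norm_num)] at hx
    have hp := hpos x hx
    have h0 : 1 - x ^ 2 / c ^ 2 ≠ 0 := by
      have : 1 - x ^ 2 / c ^ 2 = (c ^ 2 - x ^ 2) / c ^ 2 := by field_simp
      rw [this]; positivity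
    have h1 := (((hasDerivAt_pow 2 x).div_const (c ^ 2)).const_sub 1).log h0
    refine (((hasDerivAt_pow 2 x).const_mul (-2)).sub (h1.const_mul (2 * c ^ 2))).congr_deriv ?_
    have hp' := hp.ne'
    have : 1 - x ^ 2 / c ^ 2 = (c ^ 2 - x ^ 2) / c ^ 2 := by field_simp
    rw [this]
    simp
    field_simp
    ring
  rw [intervalIntegral.integral_eq_sub_of_hasDerivAt hd]
  · have : (1/2 : ℝ) ^ 2 / c ^ 2 = 1 / (4 * c ^ 2) := by field_simp; norm_num
    rw [this]
    simp
    ring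
  · apply ContinuousOn.intervalIntegrable
    rw [Set.uIcc_of_le (by norm_num)]
    exact ContinuousOn.div (by fun_prop) (by fun_prop) fun x hx => (hpos x hx).ne'

end SumLog

open SumLog
/-- `∑_{k≥1} [-1/2 - 2k² log(1 - 1/(4k²))] = 7ζ(3)/(4π²) + 1/4 - (1/2) log 2`,
where `ζ(3) = ∑_{m≥1} 1/m³`. -/
theorem sum_log_series_zeta3 :
    HasSum (fun k : ℕ =>
        -(1 / 2 : ℝ) - 2 * ((k : ℝ) + 1) ^ 2 * Real.log (1 - 1 / (4 * ((k : ℝ) + 1) ^ 2)))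
      (7 * (∑' m : ℕ, 1 / ((m : ℝ) + 1) ^ 3) / (4 * Real.pi ^ 2) + 1 / 4
        - (1 / 2) * Real.log 2) := by
  have hval : ∫ x in (0:ℝ)..(1/2), (2 * x - 2 * π * (g x * cos (π * x))) =
      7 * (∑' m : ℕ, 1 / ((m : ℝ) + 1) ^ 3) / (4 * Real.pi ^ 2) + 1 / 4
        - (1 / 2) * Real.log 2 := by
    rw [intervalIntegral.integral_sub, intervalIntegral.integral_const_mul,
      intervalIntegral.integral_const_mul, int_cot, integral_id]
    · field_simp
      ring
    · exact Continuous.intervalIntegrable (by fun_prop) _ _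
    · apply ContinuousOn.intervalIntegrable
      rw [Set.uIcc_of_le (by norm_num)]
      exact continuousOn_const.mul (g_cont.mul (by fun_prop))
  rw [← hval]
  simp_rw [← int_term]
  have hsum : Summable (fun k : ℕ => 1 / ((k : ℝ) + 1) ^ 2) := by
    have := (summable_nat_add_iff 1).2 (Real.summable_one_div_nat_pow (p := 2) |>.2 (by norm_num))
    simpa using this
  have hmem : ∀ x ∈ Set.uIoc (0:ℝ) (1/2), x ∈ Set.Icc (0:ℝ) (1/2) := by
    intro x hx
    rw [Set.uIoc_of_le (by norm_num)] at hx
    exact Set.Ioc_subset_Icc_self hx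
  apply intervalIntegral.hasSum_integral_of_dominated_convergence
    (fun (k : ℕ) _ => 1 / ((k : ℝ) + 1) ^ 2)
  · intro k
    exact Measurable.aestronglyMeasurable (by fun_prop)
  · intro k
    refine Filter.Eventually.of_forall fun x hx => ?_
    have hx' := hmem x hx
    have hd := den_pos k hx'
    have hk : (0 : ℝ) < (k + 1) ^ 2 := by positivity
    have hp : 0 < ((k : ℝ) + 1) ^ 2 - x ^ 2 := by linarith
    have hx0 := hx'.1
    rw [Real.norm_of_nonneg (by positivity), div_le_div_iff₀ hp hk]
    have h8 : x ^ 3 ≤ 1 / 8 := by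
      calc x ^ 3 ≤ (1/2) ^ 3 := by gcongr; exact hx'.2
        _ = 1 / 8 := by norm_num
    nlinarith
  · exact Filter.Eventually.of_forall fun x _ => hsum
  · exact intervalIntegrable_const
  · exact Filter.Eventually.of_forall fun x hx => cot_sum (hmem x hx)
end

section
/- The sum over integers s ≥ 1 of ζ(2s)/(2^{2s}(2s+1)(2s+2)) equals 1/4 - 7ζ(3)/(4π²). -/
open Real

lemma hs_congr {M : Type*} [AddCommMonoid M] [TopologicalSpace M] {f g : ℕ → M} {a b : M}
    (h : HasSum f a) (hf : ∀ k, g k = f k) (ha : b = a) : HasSum g b := by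
  rw [ha, show g = f from funext hf]; exact h

lemma aux_cot (x : ℝ) (h0 : 0 < x) (h1 : x ≤ 1 / 2) :
    HasSum (fun k : ℕ => x ^ 2 / (((k : ℝ) + 1) ^ 2 - x ^ 2)) ((1 - π * x * Real.cot (π * x)) / 2) := by
  have hx : (x : ℂ) ∈ Complex.integerComplement := by
    rw [Complex.mem_integerComplement_iff]
    rintro ⟨n, hn⟩
    have hn' : (n : ℝ) = x := by exact_mod_cast hn
    rw [← hn'] at h0 h1
    have a : 0 < n := by exact_mod_cast h0
    have b : (1 : ℝ) ≤ n := by exact_mod_cast a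
    linarith
  have h := (summable_cotTerm hx).hasSum
  have e : ∑' n, cotTerm (x : ℂ) n = π * Complex.cot (π * x) - 1 / x := by
    rw [cot_series_rep' hx]
  rw [e] at h
  have h2 := h.mul_left (-(x : ℂ) / 2)
  rw [← Complex.hasSum_ofReal]
  refine hs_congr h2 (fun k => ?_) ?_
  · have hk : (0 : ℝ) ≤ k := k.cast_nonneg
    have n1 : x - (k + 1) ≠ 0 := by linarith
    have n2 : x + (k + 1) ≠ 0 := by linarith
    have : x ^ 2 / (((k : ℝ) + 1) ^ 2 - x ^ 2) = -x / 2 * (1 / (x - (k + 1)) + 1 / (x + (k + 1))) := by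
      have n3 : ((k : ℝ) + 1) ^ 2 - x ^ 2 ≠ 0 := by
        have : ((k : ℝ) + 1) ^ 2 - x ^ 2 = -((x - (k + 1)) * (x + (k + 1))) := by ring
        rw [this]; exact neg_ne_zero.2 (mul_ne_zero n1 n2)
      field_simp
      ring
    rw [this]
    simp [cotTerm]
  · have : (x : ℂ) ≠ 0 := by exact_mod_cast h0.ne'
    push_cast
    field_simp
    ring

lemma aux_summ (s : ℕ) : Summable (fun k : ℕ => 1 / ((k : ℝ) + 1) ^ (2 * (s + 1))) := by
  have := (summable_nat_add_iff 1).2 (Real.summable_one_div_nat_pow.2 (show 1 < 2 * (s + 1) by omega))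
  simpa using this

lemma aux_power (x : ℝ) (h0 : 0 < x) (h1 : x ≤ 1 / 2) :
    HasSum (fun s : ℕ => (∑' k : ℕ, 1 / ((k : ℝ) + 1) ^ (2 * (s + 1))) * x ^ (2 * (s + 1)))
      ((1 - π * x * Real.cot (π * x)) / 2) := by
  have hg : ∀ k : ℕ, HasSum (fun s : ℕ => (x / ((k : ℝ) + 1)) ^ (2 * (s + 1)))
      (x ^ 2 / (((k : ℝ) + 1) ^ 2 - x ^ 2)) := by
    intro k
    have hk : (0 : ℝ) ≤ k := k.cast_nonneg
    have hr : x / ((k : ℝ) + 1) < 1 := by rw [div_lt_one (by linarith)]; linarith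
    have hr0 : 0 ≤ x / ((k : ℝ) + 1) := by positivity
    have := (hasSum_geometric_of_lt_one (r := (x / ((k : ℝ) + 1)) ^ 2) (by positivity)
      (by nlinarith)).mul_left ((x / ((k : ℝ) + 1)) ^ 2)
    refine hs_congr this (fun s => ?_) ?_
    · ring
    · have n3 : ((k : ℝ) + 1) ^ 2 - x ^ 2 ≠ 0 := by nlinarith
      field_simp
  have hc := aux_cot x h0 h1
  have hs : Summable (fun p : ℕ × ℕ => (x / ((p.1 : ℝ) + 1)) ^ (2 * (p.2 + 1))) := by
    rw [summable_prod_of_nonneg]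
    · refine ⟨fun k => (hg k).summable, ?_⟩
      simp only [(hg _).tsum_eq]
      exact hc.summable
    · intro p; dsimp; positivity
  have ht := hs.hasSum
  have e := hc.unique (ht.prod_fiberwise hg)
  rw [e]
  have ht' := (Equiv.prodComm ℕ ℕ).hasSum_iff.2 ht
  refine ht'.prod_fiberwise ?_
  intro s
  have := (aux_summ s).hasSum.mul_right (x ^ (2 * (s + 1)))
  refine hs_congr this (fun k => ?_) rfl
  simp [div_pow]
  ring

lemma aux_int (s : ℕ) : ∫ x in (0:ℝ)..(1/2), (1 / 2 - x) * x ^ (2 * (s + 1)) =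
    1 / 4 * (1 / (2 ^ (2 * (s + 1)) * (2 * (s : ℝ) + 3) * (2 * (s : ℝ) + 4))) := by
  have : ∀ x : ℝ, (1 / 2 - x) * x ^ (2 * (s + 1)) = 1/2 * x ^ (2 * (s + 1)) - x ^ (2 * (s + 1) + 1) := by
    intro x; ring
  simp only [this]
  rw [intervalIntegral.integral_sub, intervalIntegral.integral_const_mul, integral_pow, integral_pow]
  · push_cast
    simp only [ne_eq, Nat.add_eq_zero_iff, one_ne_zero, and_false, not_false_eq_true, zero_pow]
    have a1 : (2 * ((s:ℝ) + 1) + 1) ≠ 0 := by positivity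
    have a2 : (2 * ((s:ℝ) + 1) + 1 + 1) ≠ 0 := by positivity
    have a3 : (2 * (s:ℝ) + 3) ≠ 0 := by positivity
    have a4 : (2 * (s:ℝ) + 4) ≠ 0 := by positivity
    rw [pow_succ, pow_succ, pow_succ, one_div_pow]
    field_simp
    ring
  · exact Continuous.intervalIntegrable (by fun_prop) _ _
  · exact Continuous.intervalIntegrable (by fun_prop) _ _

lemma aux_main : HasSum (fun s : ℕ =>
        (∑' k : ℕ, 1 / ((k : ℝ) + 1) ^ (2 * (s + 1))) /
          (2 ^ (2 * (s + 1)) * (2 * (s : ℝ) + 3) * (2 * (s : ℝ) + 4)))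
      (4 * ∫ x in (0:ℝ)..(1/2), (1 / 2 - x) * ((1 - π * x * Real.cot (π * x)) / 2)) := by
  set Z : ℕ → ℝ := fun s => ∑' k : ℕ, 1 / ((k : ℝ) + 1) ^ (2 * (s + 1)) with hZ
  have hZ0 : ∀ s, 0 ≤ Z s := fun s => tsum_nonneg fun k => by positivity
  have hZ1 : ∀ s, Z s ≤ Z 0 := by
    intro s
    refine (aux_summ s).tsum_le_tsum (fun k => ?_) (aux_summ 0)
    refine one_div_le_one_div_of_le (by positivity) ?_
    exact pow_le_pow_right₀ (by linarith [k.cast_nonneg (α := ℝ)]) (by omega)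
  have key := intervalIntegral.hasSum_integral_of_dominated_convergence (μ := MeasureTheory.volume)
    (a := (0:ℝ)) (b := 1/2)
    (F := fun (s : ℕ) x => (1 / 2 - x) * (Z s * x ^ (2 * (s + 1))))
    (f := fun x => (1 / 2 - x) * ((1 - π * x * Real.cot (π * x)) / 2))
    (fun s _ => Z 0 * (1 / 4) ^ s) (fun s => Continuous.aestronglyMeasurable (by fun_prop))
    ?_ ?_ ?_ ?_
  · refine hs_congr (key.mul_left 4) (fun s => ?_) rfl
    have : ∀ x : ℝ, (1 / 2 - x) * (Z s * x ^ (2 * (s + 1))) = Z s * ((1 / 2 - x) * x ^ (2 * (s + 1))) := by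
      intro x; ring
    simp only [this]
    rw [intervalIntegral.integral_const_mul, aux_int]
    ring
  · intro s
    refine Filter.Eventually.of_forall fun x hx => ?_
    rw [Set.uIoc_of_le (by norm_num)] at hx
    obtain ⟨h0, h1⟩ := hx
    have h2 : 0 ≤ 1 / 2 - x := by linarith
    have := hZ0 s
    rw [Real.norm_of_nonneg (by positivity)]
    have h3 : x ^ (2 * (s + 1)) ≤ (1 / 4) ^ s := by
      rw [pow_mul]
      calc (x ^ 2) ^ (s + 1) ≤ (1 / 4) ^ (s + 1) := by
            apply pow_le_pow_left₀ (by positivity); nlinarith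
        _ ≤ (1 / 4) ^ s := pow_le_pow_of_le_one (by norm_num) (by norm_num) (by omega)
    calc (1 / 2 - x) * (Z s * x ^ (2 * (s + 1))) ≤ 1 * (Z s * x ^ (2 * (s + 1))) := by
          gcongr; linarith
      _ ≤ Z 0 * (1 / 4) ^ s := by rw [one_mul]; gcongr; exact hZ1 s
  · refine Filter.Eventually.of_forall fun x hx => ?_
    exact (summable_geometric_of_lt_one (by norm_num) (by norm_num)).mul_left _
  · exact intervalIntegrable_const
  · refine Filter.Eventually.of_forall fun x hx => ?_
    rw [Set.uIoc_of_le (by norm_num)] at hx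
    exact (aux_power x hx.1 hx.2).mul_left _

lemma aux_zeta : HasSum (fun k : ℕ => (1 + (-1) ^ k) * (1 / ((k : ℝ) + 1) ^ 3))
    (7 / 4 * ∑' m : ℕ, 1 / ((m : ℝ) + 1) ^ 3) := by
  have hf : Summable (fun k : ℕ => 1 / ((k : ℝ) + 1) ^ 3) := by
    simpa using (summable_nat_add_iff 1).2 (Real.summable_one_div_nat_pow.2 (show 1 < 3 by omega))
  have ho : HasSum (fun k : ℕ => 1 / (((2 * k + 1 : ℕ) : ℝ) + 1) ^ 3)
      (1 / 8 * ∑' m : ℕ, 1 / ((m : ℝ) + 1) ^ 3) := by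
    refine hs_congr (hf.hasSum.mul_left (1 / 8)) (fun k => ?_) rfl
    push_cast
    rw [show (2 * (k : ℝ) + 1 + 1) = 2 * (k + 1) by ring, mul_pow]
    field_simp
    norm_num
  have he : Summable (fun k : ℕ => 1 / (((2 * k : ℕ) : ℝ) + 1) ^ 3) :=
    hf.comp_injective (i := fun k : ℕ => 2 * k) (fun a b h => by simpa using h)
  have e := (he.hasSum.even_add_odd (f := fun k : ℕ => 1 / ((k : ℝ) + 1) ^ 3) ho).unique hf.hasSum
  have h2 : HasSum (fun k : ℕ => (1 + (-1) ^ (2 * k)) * (1 / (((2 * k : ℕ) : ℝ) + 1) ^ 3))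
      (7 / 4 * ∑' m : ℕ, 1 / ((m : ℝ) + 1) ^ 3) := by
    refine hs_congr (he.hasSum.mul_left 2) (fun k => ?_) ?_
    · rw [pow_mul]; norm_num
    · linarith
  have h3 : HasSum (fun k : ℕ => (1 + (-1) ^ (2 * k + 1)) * (1 / (((2 * k + 1 : ℕ) : ℝ) + 1) ^ 3)) 0 := by
    refine hs_congr hasSum_zero (fun k => ?_) rfl
    rw [pow_succ, pow_mul]; norm_num
  simpa using h2.even_add_odd (f := fun k : ℕ => (1 + (-1) ^ k) * (1 / ((k : ℝ) + 1) ^ 3)) h3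

lemma aux_coef (k : ℕ) : ∫ x in (0:ℝ)..(1/2), (1 / 2 - x) * x * (2 * π * Real.sin (2 * π * (k + 1) * x)) =
    1 / (2 * π ^ 2) * ((1 + (-1) ^ k) * (1 / ((k : ℝ) + 1) ^ 3)) := by
  have hk : (k : ℝ) + 1 ≠ 0 := by positivity
  obtain ⟨a, ha⟩ : ∃ a : ℝ, a = 2 * π * (k + 1) := ⟨_, rfl⟩
  have ha0 : a ≠ 0 := by rw [ha]; positivity
  rw [← ha]
  have hd : ∀ x : ℝ, HasDerivAt (fun x : ℝ => 2 * π * (-((1 / 2 - x) * x) * Real.cos (a * x) / a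
      + (1 / 2 - 2 * x) * Real.sin (a * x) / a ^ 2 - 2 * Real.cos (a * x) / a ^ 3))
      ((1 / 2 - x) * x * (2 * π * Real.sin (a * x))) x := by
    intro x
    have hx := hasDerivAt_id x
    have hax : HasDerivAt (fun x => a * x) a x := by simpa using hx.const_mul a
    have hc := hax.cos
    have hs := hax.sin
    have := ((((((hx.const_sub (1 / 2)).mul hx).neg.mul hc).div_const a).add
      ((((hx.const_mul 2).const_sub (1 / 2)).mul hs).div_const (a ^ 2))).sub
      ((hc.const_mul 2).div_const (a ^ 3))).const_mul (2 * π)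
    refine this.congr_deriv ?_
    simp
    field_simp
    ring
  rw [intervalIntegral.integral_eq_sub_of_hasDerivAt (fun x _ => hd x)
    (Continuous.intervalIntegrable (by fun_prop) _ _)]
  have e : a * (1 / 2) = ((k + 1 : ℕ) : ℝ) * π := by rw [ha]; push_cast; ring
  rw [e, Real.cos_nat_mul_pi, Real.sin_nat_mul_pi, ha]
  simp
  field_simp
  ring

lemma aux_sum_sin (N : ℕ) (y : ℝ) : Real.sin y * ∑ k ∈ Finset.range N, 2 * Real.sin (2 * (k + 1) * y) =
    Real.cos y - Real.cos ((2 * N + 1) * y) := by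
  induction N with
  | zero => simp
  | succ n ih =>
    rw [Finset.sum_range_succ, mul_add, ih]
    have h1 : (2 * (n : ℝ) + 1) * y = 2 * (n + 1) * y - y := by ring
    have h2 : (2 * ((n + 1 : ℕ) : ℝ) + 1) * y = 2 * (n + 1) * y + y := by push_cast; ring
    rw [h1, h2, Real.cos_sub, Real.cos_add]
    ring

lemma aux_sinbd (x : ℝ) (h0 : 0 < x) (h1 : x ≤ 1 / 2) : 2 * x ≤ Real.sin (π * x) := by
  have := Real.mul_le_sin (x := π * x) (by positivity) (by nlinarith [Real.pi_pos])
  have e : 2 / π * (π * x) = 2 * x := by field_simp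
  linarith

lemma aux_bdd (w : ℝ → ℝ) (hm : Measurable w) (hw : ∀ x, |w x| ≤ 1) :
    IntervalIntegrable (fun x => (1 / 2 - x) * x * π * (w x / Real.sin (π * x))) MeasureTheory.volume 0 (1/2) := by
  refine (intervalIntegrable_const (c := π)).mono_fun
    (Measurable.aestronglyMeasurable (by fun_prop)) ?_
  rw [Filter.EventuallyLE, MeasureTheory.ae_restrict_iff' measurableSet_uIoc]
  refine Filter.Eventually.of_forall fun x hx => ?_
  rw [Set.uIoc_of_le (by norm_num)] at hx
  obtain ⟨h0, h1⟩ := hx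
  have hs := aux_sinbd x h0 h1
  have hp : 0 < Real.sin (π * x) := by linarith
  have h2 : 0 ≤ 1 / 2 - x := by linarith
  rw [Real.norm_eq_abs, Real.norm_eq_abs, abs_of_pos Real.pi_pos, abs_mul, abs_div, abs_of_pos hp,
    abs_of_nonneg (by positivity)]
  have : (1 / 2 - x) * x * π * (|w x| / Real.sin (π * x)) = π * ((1 / 2 - x) * x * |w x| / Real.sin (π * x)) := by ring
  rw [this]
  have hle : (1 / 2 - x) * x * |w x| / Real.sin (π * x) ≤ 1 := by
    rw [div_le_one hp]
    have := hw x
    calc (1 / 2 - x) * x * |w x| ≤ (1 / 2 - x) * x * 1 := by gcongr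
      _ ≤ _ := by nlinarith
  nlinarith [Real.pi_pos]

lemma aux_RL (g : ℝ → ℝ) (hg : IntervalIntegrable g MeasureTheory.volume 0 (1/2)) :
    Filter.Tendsto (fun N : ℕ => ∫ x in (0:ℝ)..(1/2), g x * Real.cos ((2 * N + 1) * (π * x)))
      Filter.atTop (nhds 0) := by
  have h := Real.tendsto_integral_exp_smul_cocompact
    (Set.indicator (Set.Ioc (0:ℝ) (1/2)) (fun x => (g x : ℂ)))
  have ht : Filter.Tendsto (fun N : ℕ => (N : ℝ) + 1 / 2) Filter.atTop (Filter.cocompact ℝ) :=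
    (Filter.tendsto_atTop_add_const_right _ _ tendsto_natCast_atTop_atTop).mono_right
      atTop_le_cocompact
  have h2 := (Complex.continuous_re.tendsto _).comp (h.comp ht)
  simp only [Complex.zero_re] at h2
  refine h2.congr fun N => ?_
  simp only [Function.comp]
  have e : ∀ v : ℝ, Real.fourierChar (-(v * ((N : ℝ) + 1 / 2))) •
      Set.indicator (Set.Ioc (0:ℝ) (1/2)) (fun x => (g x : ℂ)) v =
      Set.indicator (Set.Ioc (0:ℝ) (1/2)) (fun x => Complex.exp (((-((2 * N + 1) * (π * x)) : ℝ) : ℂ) * Complex.I) * (g x : ℂ)) v := by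
    intro v
    by_cases hv : v ∈ Set.Ioc (0:ℝ) (1/2)
    · rw [Set.indicator_of_mem hv, Set.indicator_of_mem hv, Circle.smul_def, Real.fourierChar_apply,
        smul_eq_mul]
      congr 4
      ring
    · rw [Set.indicator_of_notMem hv, Set.indicator_of_notMem hv, smul_zero]
  simp only [e]
  rw [MeasureTheory.integral_indicator measurableSet_Ioc,
    ← intervalIntegral.integral_of_le (by norm_num)]
  have hgc : IntervalIntegrable (fun x => (g x : ℂ)) MeasureTheory.volume 0 (1/2) :=
    ⟨hg.1.ofReal, hg.2.ofReal⟩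
  have hi := hgc.continuousOn_mul (g := fun x : ℝ => Complex.exp (((-((2 * N + 1) * (π * x)) : ℝ) : ℂ) * Complex.I))
    (Continuous.continuousOn (by fun_prop))
  have := Complex.reCLM.intervalIntegral_comp_comm hi
  simp only [Complex.reCLM_apply] at this
  rw [← this]
  refine intervalIntegral.integral_congr fun x _ => ?_
  simp only [Complex.re_mul_ofReal, Complex.exp_ofReal_mul_I_re, Real.cos_neg]
  ring

lemma aux_cot_int : ∫ x in (0:ℝ)..(1/2), (1 / 2 - x) * x * π * Real.cot (π * x) =
    7 / (8 * π ^ 2) * ∑' m : ℕ, 1 / ((m : ℝ) + 1) ^ 3 := by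
  have h1 := (aux_zeta.mul_left (1 / (2 * π ^ 2))).tendsto_sum_nat
  simp only [← aux_coef] at h1
  have hg := aux_bdd (fun _ => 1) measurable_const (by simp)
  have hc := aux_bdd (fun x => Real.cos (π * x)) (by fun_prop) (fun x => Real.abs_cos_le_one _)
  have h2 := aux_RL _ hg
  have h3 := h1.add h2
  have h4 : ∀ N : ℕ, (∑ k ∈ Finset.range N,
      ∫ x in (0:ℝ)..(1/2), (1 / 2 - x) * x * (2 * π * Real.sin (2 * π * (k + 1) * x))) +
      (∫ x in (0:ℝ)..(1/2), (1 / 2 - x) * x * π * (1 / Real.sin (π * x)) * Real.cos ((2 * N + 1) * (π * x))) =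
      ∫ x in (0:ℝ)..(1/2), (1 / 2 - x) * x * π * Real.cot (π * x) := by
    intro N
    rw [← intervalIntegral.integral_finsetSum, ← intervalIntegral.integral_add]
    · refine intervalIntegral.integral_congr_ae (Filter.Eventually.of_forall fun x hx => ?_)
      rw [Set.uIoc_of_le (by norm_num)] at hx
      have hp : Real.sin (π * x) ≠ 0 := by linarith [aux_sinbd x hx.1 hx.2, hx.1]
      have hs := aux_sum_sin N (π * x)
      have e : ∑ k ∈ Finset.range N, (1 / 2 - x) * x * (2 * π * Real.sin (2 * π * (k + 1) * x)) =
          (1 / 2 - x) * x * π * ∑ k ∈ Finset.range N, 2 * Real.sin (2 * (k + 1) * (π * x)) := by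
        rw [Finset.mul_sum]
        refine Finset.sum_congr rfl fun k _ => ?_
        rw [show 2 * π * ((k : ℝ) + 1) * x = 2 * (k + 1) * (π * x) by ring]
        ring
      rw [e, Real.cot_eq_cos_div_sin]
      have hcos : Real.cos (π * x) = Real.sin (π * x) * (∑ k ∈ Finset.range N, 2 * Real.sin (2 * (k + 1) * (π * x))) + Real.cos ((2 * N + 1) * (π * x)) := by
        linarith
      rw [hcos, add_div, mul_div_cancel_left₀ _ hp]
      ring
    · exact Continuous.intervalIntegrable (by fun_prop) _ _
    · exact hg.mul_continuousOn (Continuous.continuousOn (by fun_prop))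
    · intro k _
      exact Continuous.intervalIntegrable (by fun_prop) _ _
  simp only [h4] at h3
  rw [tendsto_nhds_unique tendsto_const_nhds h3]
  ring

theorem sum_zeta_even_euler_identity :
    HasSum (fun s : ℕ =>
        (∑' k : ℕ, 1 / ((k : ℝ) + 1) ^ (2 * (s + 1))) /
          (2 ^ (2 * (s + 1)) * (2 * (s : ℝ) + 3) * (2 * (s : ℝ) + 4)))
      (1 / 4 - 7 * (∑' m : ℕ, 1 / ((m : ℝ) + 1) ^ 3) / (4 * Real.pi ^ 2)) := by
  refine hs_congr aux_main (fun _ => rfl) ?_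
  have hc := aux_bdd (fun x => Real.cos (π * x)) (by fun_prop) (fun x => Real.abs_cos_le_one _)
  simp only [← Real.cot_eq_cos_div_sin] at hc
  have e : ∀ x : ℝ, (1 / 2 - x) * ((1 - π * x * Real.cot (π * x)) / 2) =
      (1 / 2) * (1 / 2 - x) - (1 / 2) * ((1 / 2 - x) * x * π * Real.cot (π * x)) := by
    intro x; ring
  simp only [e]
  rw [intervalIntegral.integral_sub, intervalIntegral.integral_const_mul,
    intervalIntegral.integral_const_mul, aux_cot_int, intervalIntegral.integral_sub]
  · simp
    field_simp
    ring
  · exact Continuous.intervalIntegrable (by fun_prop) _ _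
  · exact Continuous.intervalIntegrable (by fun_prop) _ _
  · exact Continuous.intervalIntegrable (by fun_prop) _ _
  · exact hc.const_mul _
end
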